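/- arXiv:2012.11980 — 2 statements merged into one kernel-verified Lean document; each statement's English description precedes it below -/
import Mathlib

section
/- Let (Ω, μ) be a measure space, N ≥ 1, let p > 2 be a real number and set s := 2p/(p−2). Let f : Ω → ℝ and G, H : Ω → ℝ^N be measurable, let K > 0 be a constant with |f(x)| ≤ K for μ-almost every x, and assume f ∈ L¹(Ω, μ), G ∈ L^p(Ω, μ; ℝ^N) and H ∈ L²(Ω, μ; ℝ^N). Then the function x ↦ f(x)⟨G(x), H(x)⟩ is μ-integrable and |∫_Ω f(x) ⟨G(x), H(x)⟩ dμ| ≤ K^{(s−1)/s} · ‖f‖_{L¹}^{1/s} · ‖G‖_{L^p} · ‖H‖_{L²}. -/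
open MeasureTheory Real RealInnerProductSpace

/-- Hölder's inequality for finitely many nonnegative integrable real functions, with weights
summing to one. -/
theorem integrable_prod_rpow_and_integral_le {α ι : Type*} [MeasurableSpace α] {μ : Measure α}
    (t : Finset ι) {u : ι → α → ℝ} (hu : ∀ i ∈ t, Integrable (u i) μ)
    (hu0 : ∀ i ∈ t, ∀ x, 0 ≤ u i x) {w : ι → ℝ} (hw : ∑ i ∈ t, w i = 1)
    (hw0 : ∀ i ∈ t, 0 ≤ w i) :
    Integrable (fun x => ∏ i ∈ t, u i x ^ w i) μ ∧
      ∫ x, ∏ i ∈ t, u i x ^ w i ∂μ ≤ ∏ i ∈ t, (∫ x, u i x ∂μ) ^ w i := by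
  have prod_nonneg (x : α) : 0 ≤ ∏ i ∈ t, u i x ^ w i :=
    Finset.prod_nonneg fun i hi => rpow_nonneg (hu0 i hi x) _
  have integral_nonneg' (i : ι) (hi : i ∈ t) : 0 ≤ ∫ x, u i x ∂μ := integral_nonneg (hu0 i hi)
  have lintegral_le : ∫⁻ x, ENNReal.ofReal (∏ i ∈ t, u i x ^ w i) ∂μ ≤
      ENNReal.ofReal (∏ i ∈ t, (∫ x, u i x ∂μ) ^ w i) := by
    calc ∫⁻ x, ENNReal.ofReal (∏ i ∈ t, u i x ^ w i) ∂μ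
        = ∫⁻ x, ∏ i ∈ t, ENNReal.ofReal (u i x) ^ w i ∂μ := by
          refine lintegral_congr fun x => ?_
          rw [ENNReal.ofReal_prod_of_nonneg fun i hi => rpow_nonneg (hu0 i hi x) _]
          exact Finset.prod_congr rfl fun i hi =>
            (ENNReal.ofReal_rpow_of_nonneg (hu0 i hi x) (hw0 i hi)).symm
      _ ≤ ∏ i ∈ t, (∫⁻ x, ENNReal.ofReal (u i x) ∂μ) ^ w i :=
          ENNReal.lintegral_prod_norm_pow_le t
            (fun i hi => (hu i hi).aemeasurable.ennreal_ofReal) hw hw0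
      _ = ENNReal.ofReal (∏ i ∈ t, (∫ x, u i x ∂μ) ^ w i) := by
          rw [ENNReal.ofReal_prod_of_nonneg fun i hi => rpow_nonneg (integral_nonneg' i hi) _]
          refine Finset.prod_congr rfl fun i hi => ?_
          rw [← ofReal_integral_eq_lintegral_ofReal (hu i hi) (ae_of_all _ (hu0 i hi)),
            ENNReal.ofReal_rpow_of_nonneg (integral_nonneg' i hi) (hw0 i hi)]
  have meas : AEStronglyMeasurable (fun x => ∏ i ∈ t, u i x ^ w i) μ :=
    (t.aemeasurable_fun_prod fun i hi =>
      (hu i hi).aemeasurable.pow_const _).aestronglyMeasurable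
  refine ⟨⟨meas, ?_⟩, ?_⟩
  · rw [hasFiniteIntegral_iff_ofReal (ae_of_all _ prod_nonneg)]
    exact lintegral_le.trans_lt ENNReal.ofReal_lt_top
  · rw [integral_eq_lintegral_of_nonneg_ae (ae_of_all _ prod_nonneg) meas]
    exact ENNReal.toReal_le_of_le_ofReal
      (Finset.prod_nonneg fun i hi => rpow_nonneg (integral_nonneg' i hi) _) lintegral_le

/-- A nonnegative number bounded by `K` interpolates between `K` and itself. -/
theorem le_rpow_mul_rpow_of_le {a K s : ℝ} (ha : 0 ≤ a) (haK : a ≤ K) (hs : 1 ≤ s) :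
    a ≤ K ^ ((s - 1) / s) * a ^ (1 / s) := by
  have hs0 : 0 < s := by linarith
  have hsum : (s - 1) / s + 1 / s = 1 := by field_simp; ring
  calc a = a ^ ((s - 1) / s) * a ^ (1 / s) := by
        rw [← rpow_add_of_nonneg ha (div_nonneg (by linarith) hs0.le) (by positivity), hsum,
          rpow_one]
    _ ≤ K ^ ((s - 1) / s) * a ^ (1 / s) := by
        gcongr

/-- Vector-field version of the Hölder/Lemma-1 estimate: for `|f| ≤ K` a.e., `f ∈ L¹`,
`G ∈ Lᵖ(Ω; ℝᴺ)`, `H ∈ L²(Ω; ℝᴺ)` and `s = 2p/(p-2)`, the function `x ↦ f x ⟨G x, H x⟩`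
is integrable and `|∫ f ⟨G, H⟩| ≤ K^{(s-1)/s} ‖f‖_{L¹}^{1/s} ‖G‖_{Lᵖ} ‖H‖_{L²}`. -/
theorem holder_lemma1_vector
    {Ω : Type*} [MeasurableSpace Ω] (μ : Measure Ω)
    (N : ℕ) (hN : 1 ≤ N)
    (p : ℝ) (hp : 2 < p) (s : ℝ) (hs : s = 2 * p / (p - 2))
    (f : Ω → ℝ) (G H : Ω → EuclideanSpace ℝ (Fin N))
    (hf : Measurable f) (hG : Measurable G) (hH : Measurable H)
    (K : ℝ) (hK : 0 < K) (hfbd : ∀ᵐ x ∂μ, |f x| ≤ K)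
    (hfL1 : Integrable f μ)
    (hGLp : Integrable (fun x => ‖G x‖ ^ p) μ)
    (hHL2 : Integrable (fun x => ‖H x‖ ^ 2) μ) :
    Integrable (fun x => f x * ⟪G x, H x⟫) μ ∧
      |∫ x, f x * ⟪G x, H x⟫ ∂μ| ≤
        K ^ ((s - 1) / s) * (∫ x, |f x| ∂μ) ^ (1 / s) *
          (∫ x, ‖G x‖ ^ p ∂μ) ^ (1 / p) *
            (∫ x, ‖H x‖ ^ 2 ∂μ) ^ ((1 : ℝ) / 2) := by
  have hp2 : 0 < p - 2 := by linarith
  have hp0 : 0 < p := by linarith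
  have hs1 : 1 ≤ s := by rw [hs, le_div_iff₀ hp2]; linarith
  have hs0 : 0 < s := by linarith
  have hexp : 1 / s + 1 / p + 1 / 2 = 1 := by rw [hs]; field_simp; ring
  obtain ⟨hint, hle⟩ := integrable_prod_rpow_and_integral_le (μ := μ) Finset.univ
    (u := ![fun x => |f x|, fun x => ‖G x‖ ^ p, fun x => ‖H x‖ ^ 2])
    (w := ![1 / s, 1 / p, 1 / 2])
    (by simpa [Fin.forall_fin_succ] using ⟨hfL1.abs, hGLp, hHL2⟩)
    (by simpa [Fin.forall_fin_succ] using fun x => rpow_nonneg (norm_nonneg (G x)) p)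
    (by simpa [Fin.sum_univ_succ, add_assoc] using hexp)
    (by simpa [Fin.forall_fin_succ] using ⟨hs0.le, hp0.le⟩)
  simp only [Fin.prod_univ_three, Matrix.cons_val] at hint hle
  have hbound : ∀ᵐ x ∂μ, ‖f x * ⟪G x, H x⟫‖ ≤ K ^ ((s - 1) / s) *
      (|f x| ^ (1 / s) * (‖G x‖ ^ p) ^ (1 / p) * (‖H x‖ ^ 2) ^ ((1 : ℝ) / 2)) := by
    filter_upwards [hfbd] with x hx
    rw [one_div p, rpow_rpow_inv (norm_nonneg _) hp0.ne', ← sqrt_eq_rpow,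
      sqrt_sq (norm_nonneg _), norm_mul, norm_eq_abs]
    calc |f x| * ‖⟪G x, H x⟫‖
        ≤ (K ^ ((s - 1) / s) * |f x| ^ (1 / s)) * (‖G x‖ * ‖H x‖) :=
          mul_le_mul (le_rpow_mul_rpow_of_le (abs_nonneg _) hx hs1) (norm_inner_le_norm _ _)
            (norm_nonneg _) (by positivity)
      _ = K ^ ((s - 1) / s) * (|f x| ^ (1 / s) * ‖G x‖ * ‖H x‖) := by ring
  have hdom := hint.const_mul (K ^ ((s - 1) / s))
  refine ⟨hdom.mono' (hf.mul (hG.inner hH)).aestronglyMeasurable hbound, ?_⟩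
  refine (norm_integral_le_of_norm_le hdom hbound).trans ?_
  rw [integral_const_mul]
  refine (mul_le_mul_of_nonneg_left hle (by positivity)).trans_eq ?_
  ring
end

section
/- Let (Ω, μ) be a finite measure space and N ≥ 1. Let p > 2 be a real number and s := 2p/(p−2). Let 0 < a̲ ≤ ā and 0 < c̲ ≤ c̄ be real numbers and let a, a', c, c' : Ω → ℝ be measurable functions with a̲ ≤ a(x) ≤ ā, a̲ ≤ a'(x) ≤ ā, c̲ ≤ c(x) ≤ c̄ and c̲ ≤ c'(x) ≤ c̄ for μ-almost every x. Let u, u' : Ω → ℝ and Du, Du' : Ω → ℝ^N be measurable, and set w := u − u' and Dw := Du − Du' (pointwise). Assume w ∈ L²(Ω, μ), Dw ∈ L²(Ω, μ; ℝ^N), u ∈ L²(Ω, μ), Du ∈ L²(Ω, μ; ℝ^N), u' ∈ L^p(Ω, μ) and Du' ∈ L^p(Ω, μ; ℝ^N), and that the weak-formulation identity ∫_Ω a ⟨Du, Dw⟩ dμ + ∫_Ω c·u·w dμ = ∫_Ω a' ⟨Du', Dw⟩ dμ + ∫_Ω c'·u'·w dμ holds. Then min(a̲, c̲) · (‖Dw‖_{L²}²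 + ‖w‖_{L²}²) ≤ 2 · (max(ā − a̲, c̄ − c̲))^{(s−1)/s} · (‖u'‖_{L^p} + ‖Du'‖_{L^p}) · (‖a − a'‖_{L¹} + ‖c − c'‖_{L¹})^{1/s} · (‖Dw‖_{L²}² + ‖w‖_{L²}²)^{1/2}. -/
open MeasureTheory Real RealInnerProductSpace

section Helpers

variable {Ω : Type*} [MeasurableSpace Ω] {μ : Measure Ω}

/-- An `L^s` norm is controlled by the `L^∞` bound and the `L¹` norm. -/
theorem integral_rpow_le_of_bound {f : Ω → ℝ} {M s : ℝ} (hs : 1 ≤ s)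
    (hfm : AEStronglyMeasurable f μ) (hf : Integrable f μ) (hfM : ∀ᵐ x ∂μ, |f x| ≤ M) :
    Integrable (fun x => |f x| ^ s) μ ∧
      ∫ x, |f x| ^ s ∂μ ≤ M ^ (s - 1) * ∫ x, |f x| ∂μ := by
  have hle : ∀ᵐ x ∂μ, |f x| ^ s ≤ M ^ (s - 1) * |f x| := by
    filter_upwards [hfM] with x hx
    have h0 := abs_nonneg (f x)
    calc |f x| ^ s = |f x| ^ (s - 1) * |f x| := by
          rw [← Real.rpow_add_one' h0 (by linarith), sub_add_cancel]
      _ ≤ M ^ (s - 1) * |f x| := by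
          gcongr
  have hint : Integrable (fun x => M ^ (s - 1) * |f x|) μ := hf.abs.const_mul _
  have hpow : Integrable (fun x => |f x| ^ s) μ := by
    refine hint.mono' ?_ ?_
    · exact (hfm.norm.aemeasurable.pow_const s).aestronglyMeasurable
    · filter_upwards [hle] with x hx
      rwa [Real.norm_of_nonneg (by positivity)]
  refine ⟨hpow, ?_⟩
  rw [← integral_const_mul]
  exact integral_mono_ae hpow hint hle

theorem memLp_of_integrable_rpow {g : Ω → ℝ} {p : ℝ} (hp : 0 < p)
    (hgm : AEStronglyMeasurable g μ) (hg : Integrable (fun x => |g x| ^ p) μ) :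
    MemLp g (ENNReal.ofReal p) μ := by
  rw [← integrable_norm_rpow_iff hgm (by simpa using hp) ENNReal.ofReal_ne_top,
    ENNReal.toReal_ofReal hp.le]
  simpa only [Real.norm_eq_abs] using hg

/-- Three-factor Hölder inequality with exponents `1/s + 1/p + 1/2 = 1`. -/
theorem integral_mul_mul_le {f g h : Ω → ℝ} {p s : ℝ} (hs : 2 < s) (hp : 2 < p)
    (hps : 2 / s + 2 / p = 1)
    (hfm : AEStronglyMeasurable f μ) (hgm : AEStronglyMeasurable g μ)
    (hhm : AEStronglyMeasurable h μ)
    (hf0 : ∀ x, 0 ≤ f x) (hg0 : ∀ x, 0 ≤ g x) (hh0 : ∀ x, 0 ≤ h x)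
    (hf : Integrable (fun x => f x ^ s) μ) (hg : Integrable (fun x => g x ^ p) μ)
    (hh : Integrable (fun x => h x ^ 2) μ) :
    Integrable (fun x => f x * g x * h x) μ ∧
    ∫ x, f x * g x * h x ∂μ ≤
      (∫ x, f x ^ s ∂μ) ^ (1 / s) * (∫ x, g x ^ p ∂μ) ^ (1 / p) *
        (∫ x, h x ^ 2 ∂μ) ^ ((1 : ℝ) / 2) := by
  have hconj : (s / 2).HolderConjugate (p / 2) := by
    rw [Real.holderConjugate_iff]
    refine ⟨by linarith, ?_⟩
    simpa [inv_div] using hps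
  have hsq : ∀ y r : ℝ, 0 ≤ y → (y ^ 2) ^ (r / 2) = y ^ r := by
    intro y r hy
    rw [← Real.rpow_natCast, ← Real.rpow_mul hy]
    congr 1
    push_cast
    ring
  have hf2 : MemLp (fun x => f x ^ 2) (ENNReal.ofReal (s / 2)) μ := by
    refine memLp_of_integrable_rpow (by linarith) (hfm.pow 2) ?_
    refine hf.congr (.of_forall fun x => ?_)
    simp only [abs_of_nonneg (sq_nonneg (f x)), hsq _ _ (hf0 x)]
  have hg2 : MemLp (fun x => g x ^ 2) (ENNReal.ofReal (p / 2)) μ := by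
    refine memLp_of_integrable_rpow (by linarith) (hgm.pow 2) ?_
    refine hg.congr (.of_forall fun x => ?_)
    simp only [abs_of_nonneg (sq_nonneg (g x)), hsq _ _ (hg0 x)]
  have hfg := integral_mul_le_Lp_mul_Lq_of_nonneg hconj
    (.of_forall fun x => sq_nonneg (f x)) (.of_forall fun x => sq_nonneg (g x)) hf2 hg2
  simp only [hsq _ _ (hf0 _), hsq _ _ (hg0 _)] at hfg
  have hfgint : Integrable (fun x => f x ^ 2 * g x ^ 2) μ := by
    have : (ENNReal.ofReal (s / 2)).HolderConjugate (ENNReal.ofReal (p / 2)) :=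
      hconj.ennrealOfReal
    exact hf2.integrable_mul hg2
  have hL2 : MemLp (fun x => f x * g x) (ENNReal.ofReal 2) μ := by
    refine memLp_of_integrable_rpow two_pos (hfm.mul hgm) ?_
    refine hfgint.congr (.of_forall fun x => ?_)
    simp [mul_pow]
  have hh2 : MemLp h (ENNReal.ofReal 2) μ := by
    refine memLp_of_integrable_rpow two_pos hhm ?_
    simpa using hh
  have hint : Integrable (fun x => f x * g x * h x) μ := by
    have : (ENNReal.ofReal 2).HolderConjugate (ENNReal.ofReal 2) :=
      Real.HolderConjugate.two_two.ennrealOfReal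
    exact hL2.integrable_mul hh2
  refine ⟨hint, ?_⟩
  have hfgh := integral_mul_le_Lp_mul_Lq_of_nonneg Real.HolderConjugate.two_two
    (.of_forall fun x => mul_nonneg (hf0 x) (hg0 x)) (.of_forall hh0) hL2 hh2
  simp only [Real.rpow_two, mul_pow] at hfgh
  refine hfgh.trans ?_
  gcongr
  have hF : 0 ≤ ∫ x, f x ^ s ∂μ := integral_nonneg fun x => Real.rpow_nonneg (hf0 x) _
  have hG : 0 ≤ ∫ x, g x ^ p ∂μ := integral_nonneg fun x => Real.rpow_nonneg (hg0 x) _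
  calc (∫ x, f x ^ 2 * g x ^ 2 ∂μ) ^ ((1 : ℝ) / 2)
      ≤ ((∫ x, f x ^ s ∂μ) ^ (1 / (s / 2)) * (∫ x, g x ^ p ∂μ) ^ (1 / (p / 2)))
          ^ ((1 : ℝ) / 2) :=
        Real.rpow_le_rpow (integral_nonneg fun x => by positivity) hfg (by norm_num)
    _ = (∫ x, f x ^ s ∂μ) ^ (1 / s) * (∫ x, g x ^ p ∂μ) ^ (1 / p) := by
        rw [Real.mul_rpow (by positivity) (by positivity), ← Real.rpow_mul hF,
          ← Real.rpow_mul hG]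
        congr 2 <;> field_simp

variable {E : Type*} [NormedAddCommGroup E] [InnerProductSpace ℝ E]

theorem integrable_mul_inner {b : Ω → ℝ} {K : ℝ} {X Y : Ω → E}
    (hbm : AEStronglyMeasurable b μ) (hb : ∀ᵐ x ∂μ, |b x| ≤ K)
    (hXm : AEStronglyMeasurable X μ) (hYm : AEStronglyMeasurable Y μ)
    (hX : Integrable (fun x => ‖X x‖ ^ 2) μ) (hY : Integrable (fun x => ‖Y x‖ ^ 2) μ) :
    Integrable (fun x => b x * ⟪X x, Y x⟫) μ := by
  have hXY : Integrable (fun x => ⟪X x, Y x⟫) μ := by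
    refine (hX.add hY).mono' (hXm.inner hYm) (.of_forall fun x => ?_)
    have := norm_inner_le_norm (𝕜 := ℝ) (X x) (Y x)
    simp only [Pi.add_apply]
    nlinarith [sq_nonneg (‖X x‖ - ‖Y x‖), sq_nonneg ‖X x‖, sq_nonneg ‖Y x‖]
  exact hXY.bdd_mul hbm (by simpa only [Real.norm_eq_abs] using hb)

/-- Coercivity of the bilinear form with coefficient `b`, tested with `U - U'`, with the
perturbation of the coefficient absorbed by Hölder's inequality. -/
theorem coercive_integral_le [IsFiniteMeasure μ] {b b' : Ω → ℝ} {l r M p s : ℝ} {U U' W : Ω → E}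
    (hl : 0 < l) (hM : r - l ≤ M) (hs : 2 < s) (hp : 2 < p) (hps : 2 / s + 2 / p = 1)
    (hbm : AEStronglyMeasurable b μ) (hbm' : AEStronglyMeasurable b' μ)
    (hUm : AEStronglyMeasurable U μ) (hUm' : AEStronglyMeasurable U' μ)
    (hb : ∀ᵐ x ∂μ, l ≤ b x ∧ b x ≤ r) (hb' : ∀ᵐ x ∂μ, l ≤ b' x ∧ b' x ≤ r)
    (hW : W = fun x => U x - U' x)
    (hU2 : Integrable (fun x => ‖U x‖ ^ 2) μ) (hW2 : Integrable (fun x => ‖W x‖ ^ 2) μ)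
    (hUp : Integrable (fun x => ‖U' x‖ ^ p) μ) :
    l * ∫ x, ‖W x‖ ^ 2 ∂μ ≤
      (∫ x, b x * ⟪U x, W x⟫ ∂μ) - (∫ x, b' x * ⟪U' x, W x⟫ ∂μ) +
        (M ^ (s - 1) * ∫ x, |b x - b' x| ∂μ) ^ (1 / s) * (∫ x, ‖U' x‖ ^ p ∂μ) ^ (1 / p) *
          (∫ x, ‖W x‖ ^ 2 ∂μ) ^ ((1 : ℝ) / 2) := by
  have hWm : AEStronglyMeasurable W μ := hW ▸ hUm.sub hUm'
  have hbK : ∀ᵐ x ∂μ, |b x| ≤ r := by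
    filter_upwards [hb] with x hx
    exact abs_le.2 ⟨by linarith, hx.2⟩
  have hbK' : ∀ᵐ x ∂μ, |b' x| ≤ r := by
    filter_upwards [hb'] with x hx
    exact abs_le.2 ⟨by linarith, hx.2⟩
  have hdM : ∀ᵐ x ∂μ, |b x - b' x| ≤ M := by
    filter_upwards [hb, hb'] with x hx hx'
    exact abs_le.2 ⟨by linarith, by linarith⟩
  have hdint : Integrable (fun x => b x - b' x) μ :=
    .of_bound (hbm.sub hbm') M (by simpa only [Real.norm_eq_abs] using hdM)
  obtain ⟨hdpow, hdle⟩ := integral_rpow_le_of_bound (by linarith : 1 ≤ s)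
    (hbm.sub hbm') hdint hdM
  obtain ⟨hHint, hH⟩ := integral_mul_mul_le hs hp hps (hbm.sub hbm').norm hUm'.norm hWm.norm
    (fun _ => norm_nonneg _) (fun _ => norm_nonneg _) (fun _ => norm_nonneg _)
    hdpow hUp hW2
  simp only [Pi.sub_apply, Real.norm_eq_abs] at hHint hH
  have hU2' : Integrable (fun x => ‖U' x‖ ^ 2) μ := by
    refine ((hU2.add hW2).const_mul 2).mono' (hUm'.norm.pow 2) (.of_forall fun x => ?_)
    have h1 : U' x = U x - W x := by simp [hW]
    have h2 := norm_sub_le (U x) (W x)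
    rw [← h1] at h2
    rw [Real.norm_of_nonneg (by positivity)]
    simp only [Pi.add_apply]
    nlinarith [sq_nonneg (‖U x‖ - ‖W x‖), norm_nonneg (U' x)]
  have hI := integrable_mul_inner hbm hbK hUm hWm hU2 hW2
  have hI' := integrable_mul_inner hbm' hbK' hUm' hWm hU2' hW2
  have hmono : l * ∫ x, ‖W x‖ ^ 2 ∂μ ≤
      (∫ x, b x * ⟪U x, W x⟫ ∂μ) - (∫ x, b' x * ⟪U' x, W x⟫ ∂μ) +
        ∫ x, |b x - b' x| * ‖U' x‖ * ‖W x‖ ∂μ := by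
    rw [← integral_sub hI hI', ← integral_const_mul]
    refine (integral_mono_ae (hW2.const_mul l) ((hI.sub hI').add hHint) ?_).trans_eq
      (integral_add (hI.sub hI') hHint)
    filter_upwards [hb] with x hx
    have hUx : U x = W x + U' x := by simp [hW]
    have h1 : ⟪U x, W x⟫ = ‖W x‖ ^ 2 + ⟪U' x, W x⟫ := by
      rw [hUx, inner_add_left, real_inner_self_eq_norm_sq]
    have h2 : -((b x - b' x) * ⟪U' x, W x⟫) ≤ |b x - b' x| * ‖U' x‖ * ‖W x‖ := by
      refine (neg_le_abs _).trans ?_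
      rw [abs_mul, mul_assoc]
      gcongr
      exact abs_real_inner_le_norm _ _
    have h3 := mul_le_mul_of_nonneg_right hx.1 (sq_nonneg ‖W x‖)
    simp only [Pi.add_apply, Pi.sub_apply, h1]
    linarith
  refine hmono.trans ?_
  gcongr
  refine hH.trans ?_
  gcongr
  exact hdle

end Helpers

/-- The key quantitative estimate in the proof of Theorem 3 of the paper (continuity
of the parameter-to-solution map in the `[L¹]²` topology):
`min(a̲,c̲)·‖w‖²_{H¹} ≤ 2 (max(ā-a̲, c̄-c̲))^{(s-1)/s} ‖u'‖_{W^{1,p}}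
  (‖a-a'‖_{L¹} + ‖c-c'‖_{L¹})^{1/s} ‖w‖_{H¹}`. -/
theorem continuity_key_estimate
    {Ω : Type*} [MeasurableSpace Ω] (μ : Measure Ω) [IsFiniteMeasure μ]
    (N : ℕ) (hN : 1 ≤ N)
    (p : ℝ) (hp : 2 < p) (s : ℝ) (hs : s = 2 * p / (p - 2))
    (alow ahigh clow chigh : ℝ)
    (halow : 0 < alow) (ha : alow ≤ ahigh) (hclow : 0 < clow) (hc : clow ≤ chigh)
    (a a' c c' u u' : Ω → ℝ) (Du Du' : Ω → EuclideanSpace ℝ (Fin N))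
    (hameas : Measurable a) (ha'meas : Measurable a')
    (hcmeas : Measurable c) (hc'meas : Measurable c')
    (humeas : Measurable u) (hu'meas : Measurable u')
    (hDumeas : Measurable Du) (hDu'meas : Measurable Du')
    (habd : ∀ᵐ x ∂μ, alow ≤ a x ∧ a x ≤ ahigh)
    (ha'bd : ∀ᵐ x ∂μ, alow ≤ a' x ∧ a' x ≤ ahigh)
    (hcbd : ∀ᵐ x ∂μ, clow ≤ c x ∧ c x ≤ chigh)
    (hc'bd : ∀ᵐ x ∂μ, clow ≤ c' x ∧ c' x ≤ chigh)
    (w : Ω → ℝ) (hw : w = fun x => u x - u' x)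
    (Dw : Ω → EuclideanSpace ℝ (Fin N)) (hDw : Dw = fun x => Du x - Du' x)
    (hwL2 : Integrable (fun x => |w x| ^ 2) μ)
    (hDwL2 : Integrable (fun x => ‖Dw x‖ ^ 2) μ)
    (huL2 : Integrable (fun x => |u x| ^ 2) μ)
    (hDuL2 : Integrable (fun x => ‖Du x‖ ^ 2) μ)
    (hu'Lp : Integrable (fun x => |u' x| ^ p) μ)
    (hDu'Lp : Integrable (fun x => ‖Du' x‖ ^ p) μ)
    (hweak : ∫ x, a x * ⟪Du x, Dw x⟫ ∂μ + ∫ x, c x * u x * w x ∂μ =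
             ∫ x, a' x * ⟪Du' x, Dw x⟫ ∂μ + ∫ x, c' x * u' x * w x ∂μ) :
    min alow clow * ((∫ x, ‖Dw x‖ ^ 2 ∂μ) + ∫ x, |w x| ^ 2 ∂μ) ≤
      2 * (max (ahigh - alow) (chigh - clow)) ^ ((s - 1) / s) *
        ((∫ x, |u' x| ^ p ∂μ) ^ (1 / p) + (∫ x, ‖Du' x‖ ^ p ∂μ) ^ (1 / p)) *
          ((∫ x, |a x - a' x| ∂μ) + ∫ x, |c x - c' x| ∂μ) ^ (1 / s) *
            ((∫ x, ‖Dw x‖ ^ 2 ∂μ) + ∫ x, |w x| ^ 2 ∂μ) ^ ((1 : ℝ) / 2) := by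
  have hp2 : 0 < p - 2 := by linarith
  have hs2 : 2 < s := by
    rw [hs, lt_div_iff₀ hp2]
    linarith
  have hps : 2 / s + 2 / p = 1 := by
    rw [hs]
    field_simp
    ring
  set M := max (ahigh - alow) (chigh - clow)
  have hM0 : 0 ≤ M := le_max_of_le_left (sub_nonneg.2 ha)
  have hA := coercive_integral_le (M := M) halow (le_max_left _ _) hs2 hp hps
    hameas.aestronglyMeasurable ha'meas.aestronglyMeasurable
    hDumeas.aestronglyMeasurable hDu'meas.aestronglyMeasurable
    habd ha'bd hDw hDuL2 hDwL2 hDu'Lp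
  have hC := coercive_integral_le (M := M) hclow (le_max_right _ _) hs2 hp hps
    hcmeas.aestronglyMeasurable hc'meas.aestronglyMeasurable
    humeas.aestronglyMeasurable hu'meas.aestronglyMeasurable
    hcbd hc'bd hw huL2 hwL2 hu'Lp
  have hinner : ∀ y z v : ℝ, y * ⟪z, v⟫ = y * z * v := fun y z v => by
    rw [real_inner_comm, RCLike.inner_apply, conj_trivial, mul_assoc]
  simp only [hinner, Real.norm_eq_abs] at hC
  have hX : 0 ≤ ∫ x, ‖Dw x‖ ^ 2 ∂μ := integral_nonneg fun x => by positivity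
  have hY : 0 ≤ ∫ x, |w x| ^ 2 ∂μ := integral_nonneg fun x => by positivity
  have hα : 0 ≤ ∫ x, |a x - a' x| ∂μ := integral_nonneg fun x => abs_nonneg _
  have hγ : 0 ≤ ∫ x, |c x - c' x| ∂μ := integral_nonneg fun x => abs_nonneg _
  have hP : 0 ≤ ∫ x, ‖Du' x‖ ^ p ∂μ := integral_nonneg fun x => by positivity
  have hQ : 0 ≤ ∫ x, |u' x| ^ p ∂μ := integral_nonneg fun x => by positivity
  set X := ∫ x, ‖Dw x‖ ^ 2 ∂μ
  set Y := ∫ x, |w x| ^ 2 ∂μ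
  set α := ∫ x, |a x - a' x| ∂μ
  set γ := ∫ x, |c x - c' x| ∂μ
  set P := (∫ x, ‖Du' x‖ ^ p ∂μ) ^ (1 / p)
  set Q := (∫ x, |u' x| ^ p ∂μ) ^ (1 / p)
  have hP0 : 0 ≤ P := Real.rpow_nonneg hP _
  have hQ0 : 0 ≤ Q := Real.rpow_nonneg hQ _
  have hs0 : 0 ≤ 1 / s := by positivity
  set T := (α + γ) ^ (1 / s)
  set R := (X + Y) ^ ((1 : ℝ) / 2) with hR
  set K := M ^ ((s - 1) / s)
  have hK0 : 0 ≤ K := Real.rpow_nonneg hM0 _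
  have hT0 : 0 ≤ T := by positivity
  have hR0 : 0 ≤ R := by positivity
  have hsplit : ∀ t, 0 ≤ t → t ≤ α + γ → (M ^ (s - 1) * t) ^ (1 / s) ≤ K * T := by
    intro t ht htle
    rw [Real.mul_rpow (by positivity) ht, ← Real.rpow_mul hM0, mul_one_div]
    exact mul_le_mul_of_nonneg_left (Real.rpow_le_rpow ht htle hs0) hK0
  have hXR : X ^ ((1 : ℝ) / 2) ≤ R := by
    rw [hR]
    gcongr
    linarith
  have hYR : Y ^ ((1 : ℝ) / 2) ≤ R := by
    rw [hR]
    gcongr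
    linarith
  have hbA : (M ^ (s - 1) * α) ^ (1 / s) * P * X ^ ((1 : ℝ) / 2) ≤ K * T * P * R := by
    gcongr
    exact hsplit α hα (by linarith)
  have hbC : (M ^ (s - 1) * γ) ^ (1 / s) * Q * Y ^ ((1 : ℝ) / 2) ≤ K * T * Q * R := by
    gcongr
    exact hsplit γ hγ (by linarith)
  have hmA : min alow clow * X ≤ alow * X := by
    gcongr
    exact min_le_left _ _
  have hmC : min alow clow * Y ≤ clow * Y := by
    gcongr
    exact min_le_right _ _
  have hnn : 0 ≤ K * (Q + P) * T * R := by positivity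
  calc min alow clow * (X + Y) ≤ K * (Q + P) * T * R := by linarith
    _ ≤ 2 * K * (Q + P) * T * R := by linarith
end
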